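/- Let U ⊆ B(H) be a hyperreflexive weak* closed masa-bimodule, and let V ⊆ B(H) be a masa-bimodule for which there exist λ > 0 and a sequence (Φ_n) of Schur idempotents in 𝔉H with sup_n ‖Φ_n‖ < ∞, Φ_{n+1} ≤ Φ_n (i.e., Φ_{n+1}Φ_n = Φ_{n+1}) for all n, V = ⋂_n ran Φ_n, and λ(Φ_n) ≤ λ for all n. Then the algebraic sum U + V is hyperreflexive and d(T, U + V) ≤ k(U)·λ·α(T, U + V) for all T ∈ B(H). -/

import Mathlib

open scoped InnerProductSpace Pointwise

noncomputable section

namespace SchurHyper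

/-- `B H` is the algebra of bounded linear operators on `H`. -/
abbrev B (H : Type*) [NormedAddCommGroup H] [InnerProductSpace ℂ H] : Type _ := H →L[ℂ] H

variable (H : Type*) [NormedAddCommGroup H] [InnerProductSpace ℂ H]

/-- A linear functional on `B H` is *normal* (weak* continuous) if it arises from
the duality with the trace class, i.e. it is of the form
`T ↦ ∑ₙ ⟪yₙ, T xₙ⟫` for square-summable sequences `(xₙ)`, `(yₙ)`
(recall that the inner product is conjugate-linear in its first slot). -/
def IsNormalFunctional (ω : B H →ₗ[ℂ] ℂ) : Prop :=
  ∃ x y : ℕ → H, Summable (fun n => ‖x n‖ ^ 2) ∧ Summable (fun n => ‖y n‖ ^ 2) ∧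
    ∀ T : B H, ω T = ∑' n, ⟪y n, T (x n)⟫_ℂ

/-- The weak* topology on `B H`: the topology induced by the normal functionals. -/
def weakStarTopology : TopologicalSpace (B H) :=
  TopologicalSpace.induced
    (fun (T : B H) (ω : {ω : B H →ₗ[ℂ] ℂ // IsNormalFunctional H ω}) => ω.1 T)
    inferInstance

/-- A set of operators is weak* closed if it is closed in the weak* topology. -/
def WStarClosed (X : Set (B H)) : Prop := @IsClosed _ (weakStarTopology H) X

/-- The weak* closure of a set of operators. -/
def wStarClosure (X : Set (B H)) : Set (B H) := @closure _ (weakStarTopology H) X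

/-- A map on `B H` is weak* continuous if it is continuous with respect to the
weak* topology on both sides. -/
def WStarContinuous (Φ : B H →L[ℂ] B H) : Prop :=
  @Continuous _ _ (weakStarTopology H) (weakStarTopology H) Φ

variable {H}
variable [CompleteSpace H]

/-- A maximal abelian selfadjoint subalgebra of `B H`: an abelian selfadjoint
subalgebra which contains every operator commuting with it (equivalently, it
coincides with its own commutant). -/
def IsMasa (D : StarSubalgebra ℂ (B H)) : Prop :=
  (∀ A ∈ D, ∀ C ∈ D, A * C = C * A) ∧
  (∀ T : B H, (∀ A ∈ D, T * A = A * T) → T ∈ D)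

/-- A Schur multiplier: a weak* continuous `D`-bimodule map on `B H`. -/
def IsSchurMultiplier (D : StarSubalgebra ℂ (B H)) (Φ : B H →L[ℂ] B H) : Prop :=
  WStarContinuous H Φ ∧ ∀ A ∈ D, ∀ C ∈ D, ∀ T : B H, Φ (A * T * C) = A * Φ T * C

/-- A Schur idempotent: an idempotent Schur multiplier. -/
def IsSchurIdempotent (D : StarSubalgebra ℂ (B H)) (Φ : B H →L[ℂ] B H) : Prop :=
  IsSchurMultiplier D Φ ∧ Φ.comp Φ = Φ

/-- A subspace `X ⊆ B H` is a `D`-bimodule if `D X D ⊆ X`. -/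
def IsBimodule (D : StarSubalgebra ℂ (B H)) (X : Submodule ℂ (B H)) : Prop :=
  ∀ A ∈ D, ∀ C ∈ D, ∀ T ∈ X, A * T * C ∈ X

/-- The Arveson distance `α(T, X)`. -/
def arveson (T : B H) (X : Set (B H)) : ℝ :=
  ⨆ ξ : {ξ : H // ‖ξ‖ = 1}, ⨅ S : X, ‖T ξ.1 - S.1 ξ.1‖

/-- The set of hyperreflexivity constants of `X`. -/
def hyperSet (X : Set (B H)) : Set ℝ :=
  {k | 0 < k ∧ ∀ T : B H, Metric.infDist T X ≤ k * arveson T X}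

/-- A subspace is hyperreflexive if `d(T, X) ≤ k ⬝ α(T, X)` for some `k > 0`. -/
def Hyperreflexive (X : Set (B H)) : Prop := (hyperSet X).Nonempty

/-- The hyperreflexivity constant `k(X)`: the least constant that works. -/
def hyperConst (X : Set (B H)) : ℝ := sInf (hyperSet X)

/-- The set of constants `λ` witnessing that a Schur idempotent lies in `𝔉H`. -/
def lamSet (Φ : B H →L[ℂ] B H) : Set ℝ :=
  {l | 0 < l ∧ ∀ T : B H, ‖T - Φ T‖ ≤ l * arveson T (Set.range Φ)}

/-- The class `𝔉H` of Schur idempotents `Φ` such that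
`‖T - Φ T‖ ≤ λ ⬝ α(T, ran Φ)` for some `λ > 0` and all `T`. -/
def MemFH (D : StarSubalgebra ℂ (B H)) (Φ : B H →L[ℂ] B H) : Prop :=
  IsSchurIdempotent D Φ ∧ (lamSet Φ).Nonempty

/-- The constant `λ(Φ)`: the least constant witnessing membership of `𝔉H`. -/
def lam (Φ : B H →L[ℂ] B H) : ℝ := sInf (lamSet Φ)

/-- A ternary masa-bimodule condition: `S T* R ∈ M` whenever `S, T, R ∈ M`. -/
def IsTernary (M : Submodule ℂ (B H)) : Prop :=
  ∀ S ∈ M, ∀ T ∈ M, ∀ R ∈ M, S * star T * R ∈ M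

end SchurHyper

open SchurHyper

namespace SchurHyper

open Filter Topology

section WeakStar

variable {H : Type*} [NormedAddCommGroup H] [InnerProductSpace ℂ H]

lemma summable_norm_inner_apply {x y : ℕ → H} (hx : Summable fun n => ‖x n‖ ^ 2)
    (hy : Summable fun n => ‖y n‖ ^ 2) (T : B H) :
    Summable fun n => ‖(⟪y n, T (x n)⟫_ℂ)‖ := by
  refine Summable.of_nonneg_of_le (fun _ => norm_nonneg _) (fun n => ?_)
    ((hx.add hy).mul_left ‖T‖)
  calc ‖(⟪y n, T (x n)⟫_ℂ)‖ ≤ ‖y n‖ * (‖T‖ * ‖x n‖) :=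
        (norm_inner_le_norm _ _).trans (by gcongr; exact T.le_opNorm _)
    _ = ‖T‖ * (‖x n‖ * ‖y n‖) := by ring
    _ ≤ ‖T‖ * (‖x n‖ ^ 2 + ‖y n‖ ^ 2) := by
        gcongr; nlinarith [sq_nonneg (‖x n‖ - ‖y n‖), sq_nonneg (‖x n‖ + ‖y n‖)]

lemma isNormalFunctional_add {ω ω' : B H →ₗ[ℂ] ℂ} (h : IsNormalFunctional H ω)
    (h' : IsNormalFunctional H ω') : IsNormalFunctional H (ω + ω') := by
  obtain ⟨x, y, hx, hy, hω⟩ := h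
  obtain ⟨x', y', hx', hy', hω'⟩ := h'
  let e : ℕ ≃ ℕ ⊕ ℕ := (Denumerable.eqv (ℕ ⊕ ℕ)).symm
  refine ⟨fun n => Sum.elim x x' (e n), fun n => Sum.elim y y' (e n), ?_, ?_, fun T => ?_⟩
  · refine (e.summable_iff (f := fun i => ‖Sum.elim x x' i‖ ^ 2)).2 ?_
    exact Summable.sum _ (by simpa [Function.comp_def] using hx)
      (by simpa [Function.comp_def] using hx')
  · refine (e.summable_iff (f := fun i => ‖Sum.elim y y' i‖ ^ 2)).2 ?_
    exact Summable.sum _ (by simpa [Function.comp_def] using hy)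
      (by simpa [Function.comp_def] using hy')
  · rw [e.tsum_eq (fun i => ⟪Sum.elim y y' i, T (Sum.elim x x' i)⟫_ℂ),
      Summable.tsum_sum, LinearMap.add_apply, hω, hω']
    · simp
    · simpa [Function.comp_def] using (summable_norm_inner_apply hx hy T).of_norm
    · simpa [Function.comp_def] using (summable_norm_inner_apply hx' hy' T).of_norm

lemma isNormalFunctional_smul (c : ℂ) {ω : B H →ₗ[ℂ] ℂ} (h : IsNormalFunctional H ω) :
    IsNormalFunctional H (c • ω) := by
  obtain ⟨x, y, hx, hy, hω⟩ := h
  refine ⟨fun n => c • x n, y, ?_, hy, fun T => ?_⟩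
  · simpa [norm_smul, mul_pow] using hx.mul_left (‖c‖ ^ 2)
  · simp [hω, tsum_mul_left]

lemma isNormalFunctional_zero : IsNormalFunctional H (0 : B H →ₗ[ℂ] ℂ) :=
  ⟨0, 0, by simp, by simp, by simp⟩

/-- The vector functional `T ↦ ⟪y, T x⟫`. -/
def vectorFunctional (x y : H) : B H →ₗ[ℂ] ℂ where
  toFun T := ⟪y, T x⟫_ℂ
  map_add' S T := by simp
  map_smul' c T := by simp

@[simp] lemma vectorFunctional_apply (x y : H) (T : B H) :
    vectorFunctional x y T = ⟪y, T x⟫_ℂ := rfl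

lemma isNormalFunctional_vectorFunctional (x y : H) :
    IsNormalFunctional H (vectorFunctional x y) := by
  have hs (z : H) : Summable fun n : ℕ => ‖(Pi.single 0 z : ℕ → H) n‖ ^ 2 :=
    summable_of_ne_finset_zero (s := {0}) fun n hn => by
      simp [Finset.notMem_singleton.1 hn]
  refine ⟨Pi.single 0 x, Pi.single 0 y, hs x, hs y, fun T => ?_⟩
  rw [tsum_eq_single 0 fun n hn => by simp [hn]]
  simp

/-- Weak* continuous linear functionals are normal. -/
lemma isNormalFunctional_of_continuous (ω : B H →ₗ[ℂ] ℂ)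
    (h : @Continuous _ _ (weakStarTopology H) _ ω) : IsNormalFunctional H ω := by
  have htop : weakStarTopology H = ⨅ ω : {ω : B H →ₗ[ℂ] ℂ // IsNormalFunctional H ω},
      TopologicalSpace.induced ω.1 inferInstance := by
    unfold weakStarTopology
    exact induced_to_pi (f := fun (T : B H)
      (ω : {ω : B H →ₗ[ℂ] ℂ // IsNormalFunctional H ω}) => ω.1 T)
  rw [htop] at h
  have hspan : ω ∈ Submodule.span ℂ {ω | IsNormalFunctional H ω} := by
    rw [← Subtype.range_val (s := {ω | IsNormalFunctional H ω})]
    exact (LinearMap.mem_span_iff_continuous ω).2 h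
  clear h htop
  induction hspan using Submodule.span_induction with
  | mem x hx => exact hx
  | zero => exact isNormalFunctional_zero
  | add x y _ _ hx hy => exact isNormalFunctional_add hx hy
  | smul c x _ hx => exact isNormalFunctional_smul c hx

lemma tendsto_weakStar_iff {ι : Type*} {F : Filter ι} {T : ι → B H} {S : B H} :
    Tendsto T F (@nhds _ (weakStarTopology H) S) ↔
      ∀ ω : B H →ₗ[ℂ] ℂ, IsNormalFunctional H ω → Tendsto (fun i => ω (T i)) F (𝓝 (ω S)) := by
  rw [weakStarTopology, nhds_induced, tendsto_comap_iff, tendsto_pi_nhds]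
  exact ⟨fun h ω hω => h ⟨ω, hω⟩, fun h ω => h ω.1 ω.2⟩

lemma continuous_of_isNormalFunctional {ω : B H →ₗ[ℂ] ℂ} (h : IsNormalFunctional H ω) :
    @Continuous _ _ (weakStarTopology H) _ ω :=
  (@continuous_iff_continuousAt _ _ (weakStarTopology H) _ _).2 fun _ =>
    tendsto_weakStar_iff.1 tendsto_id ω h

/-- On bounded families, weak operator convergence implies weak* convergence. -/
lemma tendsto_weakStar_of_bounded {ι : Type*} {F : Filter ι} {T : ι → B H} {S : B H} {C : ℝ}
    (hT : ∀ i, ‖T i‖ ≤ C)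
    (h : ∀ x y, Tendsto (fun i => ⟪y, T i x⟫_ℂ) F (𝓝 ⟪y, S x⟫_ℂ)) :
    Tendsto T F (@nhds _ (weakStarTopology H) S) := by
  rw [tendsto_weakStar_iff]
  rintro ω ⟨x, y, hx, hy, hω⟩
  simp only [hω]
  refine tendsto_tsum_of_dominated_convergence ((hx.add hy).mul_left C) (fun k => h _ _)
    (Eventually.of_forall fun i k => ?_)
  have hC : 0 ≤ C := (norm_nonneg _).trans (hT i)
  calc ‖(⟪y k, T i (x k)⟫_ℂ)‖ ≤ ‖y k‖ * (C * ‖x k‖) :=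
        (norm_inner_le_norm _ _).trans (by gcongr; exact (T i).le_of_opNorm_le (hT i) _)
    _ = C * (‖x k‖ * ‖y k‖) := by ring
    _ ≤ C * (‖x k‖ ^ 2 + ‖y k‖ ^ 2) := by
        gcongr; nlinarith [sq_nonneg (‖x k‖ - ‖y k‖), sq_nonneg (‖x k‖ + ‖y k‖)]

lemma opNorm_le_of_norm_inner_le {T : B H} {C : ℝ} (hC : 0 ≤ C)
    (h : ∀ x y, ‖(⟪y, T x⟫_ℂ)‖ ≤ C * ‖x‖ * ‖y‖) : ‖T‖ ≤ C := by
  refine T.opNorm_le_bound hC fun x => ?_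
  have h := h x (T x)
  rw [inner_self_eq_norm_sq_to_K] at h
  simp only [norm_pow, RCLike.norm_ofReal, abs_norm] at h
  rcases (norm_nonneg (T x)).eq_or_lt with h0 | h0
  · rw [← h0]; positivity
  · nlinarith

lemma norm_le_of_tendsto_weakStar {ι : Type*} {F : Filter ι} [F.NeBot] {T : ι → B H} {S : B H}
    {c : ι → ℝ} {C : ℝ} (h : Tendsto T F (@nhds _ (weakStarTopology H) S))
    (hc : Tendsto c F (𝓝 C)) (hT : ∀ i, ‖T i‖ ≤ c i) : ‖S‖ ≤ C := by
  have hC : 0 ≤ C := ge_of_tendsto' hc fun i => (norm_nonneg _).trans (hT i)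
  refine opNorm_le_of_norm_inner_le hC fun x y => ?_
  have hxy := tendsto_weakStar_iff.1 h _ (isNormalFunctional_vectorFunctional x y)
  refine le_of_tendsto_of_tendsto' hxy.norm ((hc.mul_const _).mul_const _) fun i => ?_
  calc ‖(⟪y, T i x⟫_ℂ)‖ ≤ ‖y‖ * (c i * ‖x‖) :=
        (norm_inner_le_norm _ _).trans (by gcongr; exact (T i).le_of_opNorm_le (hT i) _)
    _ = c i * ‖x‖ * ‖y‖ := by ring

lemma tendsto_weakStar_unique {ι : Type*} {F : Filter ι} [F.NeBot] {T : ι → B H} {S S' : B H}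
    (h : Tendsto T F (@nhds _ (weakStarTopology H) S))
    (h' : Tendsto T F (@nhds _ (weakStarTopology H) S')) : S = S' :=
  ContinuousLinearMap.ext fun x => ext_inner_left ℂ fun y =>
    tendsto_nhds_unique
      (tendsto_weakStar_iff.1 h _ (isNormalFunctional_vectorFunctional x y))
      (tendsto_weakStar_iff.1 h' _ (isNormalFunctional_vectorFunctional x y))

/-- Weak* compactness of balls, in terms of ultrafilters. -/
lemma exists_tendsto_weakStar [CompleteSpace H] {ι : Type*} (F : Ultrafilter ι) {T : ι → B H}
    {C : ℝ} (hT : ∀ i, ‖T i‖ ≤ C) :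
    ∃ S : B H, ‖S‖ ≤ C ∧ Tendsto T F (@nhds _ (weakStarTopology H) S) := by
  obtain ⟨i₀⟩ : Nonempty ι := F.neBot.nonempty
  have hC : 0 ≤ C := (norm_nonneg _).trans (hT i₀)
  have hlim (x y : H) : ∃ c : ℂ, ‖c‖ ≤ C * ‖x‖ * ‖y‖ ∧
      Tendsto (fun i => ⟪T i x, y⟫_ℂ) F (𝓝 c) := by
    obtain ⟨c, hc, hle⟩ := (isCompact_closedBall (0 : ℂ) (C * ‖x‖ * ‖y‖)).ultrafilter_le_nhds
      (F.map fun i => ⟪T i x, y⟫_ℂ) (by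
        simp only [Ultrafilter.coe_map, le_principal_iff, mem_map]
        refine univ_mem' fun i => ?_
        simp only [Set.mem_preimage, mem_closedBall_zero_iff]
        exact (norm_inner_le_norm _ _).trans (by gcongr; exact (T i).le_of_opNorm_le (hT i) _))
    exact ⟨c, by simpa using hc, hle⟩
  choose f hf hft using hlim
  let b : H →ₗ⋆[ℂ] H →ₗ[ℂ] ℂ := LinearMap.mk₂'ₛₗ (starRingEnd ℂ) (RingHom.id ℂ) f
    (fun x x' y => tendsto_nhds_unique (hft _ _)
      (by simpa [inner_add_left] using (hft x y).add (hft x' y)))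
    (fun c x y => tendsto_nhds_unique (hft _ _)
      (by simpa [inner_smul_left, mul_comm] using (hft x y).const_mul (starRingEnd ℂ c)))
    (fun x y y' => tendsto_nhds_unique (hft _ _)
      (by simpa [inner_add_right] using (hft x y).add (hft x y')))
    (fun c x y => tendsto_nhds_unique (hft _ _)
      (by simpa [inner_smul_right] using (hft x y).const_mul c))
  let S : B H := InnerProductSpace.continuousLinearMapOfBilin (b.mkContinuous₂ C hf)
  have hS (x y : H) : ⟪S x, y⟫_ℂ = f x y :=
    InnerProductSpace.continuousLinearMapOfBilin_apply _ _ _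
  refine ⟨S, opNorm_le_of_norm_inner_le hC fun x y => ?_,
    tendsto_weakStar_of_bounded hT fun x y => ?_⟩
  · rw [norm_inner_symm, hS]
    exact hf x y
  · have h := (hft x y).star
    rw [← hS] at h
    simpa using h

end WeakStar

section Modulus

variable {X : Type*} [TopologicalSpace X]

/-- The pointwise Euclidean norm of a finite family of continuous functions. -/
def euclideanModulus (s : Finset ℕ) (f : ℕ → C(X, ℂ)) : C(X, ℂ) where
  toFun p := (√(∑ n ∈ s, ‖f n p‖ ^ 2) : ℝ)
  continuous_toFun := by fun_prop

lemma star_euclideanModulus_mul_self (s : Finset ℕ) (f : ℕ → C(X, ℂ)) :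
    star (euclideanModulus s f) * euclideanModulus s f = ∑ n ∈ s, star (f n) * f n := by
  ext p
  have h : (0 : ℝ) ≤ ∑ n ∈ s, ‖f n p‖ ^ 2 := by positivity
  simp only [euclideanModulus, ContinuousMap.mul_apply, ContinuousMap.star_apply,
    ContinuousMap.coe_mk, RCLike.star_def, Complex.conj_ofReal, ContinuousMap.sum_apply,
    Complex.conj_mul']
  rw [← Complex.ofReal_mul, Real.mul_self_sqrt h]
  push_cast
  rfl

lemma sub_sqrt_sq_le_sum_norm_sub_sq (s : Finset ℕ) (z w : ℕ → ℂ) :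
    (√(∑ n ∈ s, ‖z n‖ ^ 2) - √(∑ n ∈ s, ‖w n‖ ^ 2)) ^ 2 ≤ ∑ n ∈ s, ‖z n - w n‖ ^ 2 := by
  have hcs := Real.sum_mul_le_sqrt_mul_sqrt s (fun n => ‖z n‖) (fun n => ‖w n‖)
  have h₁ : ∑ n ∈ s, (‖z n‖ - ‖w n‖) ^ 2 ≤ ∑ n ∈ s, ‖z n - w n‖ ^ 2 :=
    Finset.sum_le_sum fun n _ => sq_le_sq.2 (by
      rw [abs_norm]; exact abs_norm_sub_norm_le _ _)
  have h₂ : ∑ n ∈ s, (‖z n‖ - ‖w n‖) ^ 2 =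
      ∑ n ∈ s, ‖z n‖ ^ 2 + ∑ n ∈ s, ‖w n‖ ^ 2 - 2 * ∑ n ∈ s, ‖z n‖ * ‖w n‖ := by
    rw [Finset.mul_sum, ← Finset.sum_add_distrib, ← Finset.sum_sub_distrib]
    exact Finset.sum_congr rfl fun n _ => by ring
  rw [sub_sq, Real.sq_sqrt (by positivity), Real.sq_sqrt (by positivity)]
  linarith

lemma exists_sum_star_sub_mul_sub_eq (s : Finset ℕ) (f g : ℕ → C(X, ℂ)) :
    ∃ r : C(X, ℂ), ∑ n ∈ s, star (f n - g n) * (f n - g n) =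
      star (euclideanModulus s f - euclideanModulus s g) *
        (euclideanModulus s f - euclideanModulus s g) + star r * r := by
  let q (p : X) : ℝ := ∑ n ∈ s, ‖f n p - g n p‖ ^ 2 -
    (√(∑ n ∈ s, ‖f n p‖ ^ 2) - √(∑ n ∈ s, ‖g n p‖ ^ 2)) ^ 2
  have hq (p : X) : 0 ≤ q p := sub_nonneg.2 (sub_sqrt_sq_le_sum_norm_sub_sq s _ _)
  refine ⟨⟨fun p => (√(q p) : ℝ), by fun_prop⟩, ?_⟩
  ext p
  simp only [euclideanModulus, ContinuousMap.mul_apply, ContinuousMap.star_apply,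
    ContinuousMap.coe_mk, RCLike.star_def, Complex.conj_ofReal, ContinuousMap.sum_apply,
    ContinuousMap.add_apply, ContinuousMap.sub_apply, ← Complex.ofReal_sub, Complex.conj_mul']
  rw [← Complex.ofReal_mul (√(q p)), Real.mul_self_sqrt (hq p)]
  simp only [q]
  push_cast
  ring

lemma euclideanModulus_congr {s t : Finset ℕ} {f : ℕ → C(X, ℂ)} (hst : s ⊆ t)
    (hf : ∀ n ∈ t, n ∉ s → f n = 0) : euclideanModulus s f = euclideanModulus t f := by
  ext p
  simp only [euclideanModulus, ContinuousMap.coe_mk]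
  rw [Finset.sum_subset hst fun n hn hns => by simp [hf n hn hns]]

lemma exists_modulus (A : Type*) [CommCStarAlgebra A] :
    ∃ m : Finset ℕ → (ℕ → A) → A,
      (∀ s a, star (m s a) * m s a = ∑ n ∈ s, star (a n) * a n) ∧
      (∀ s a b, ∃ r, ∑ n ∈ s, star (a n - b n) * (a n - b n) =
        star (m s a - m s b) * (m s a - m s b) + star r * r) ∧
      ∀ s t a, s ⊆ t → (∀ n ∈ t, n ∉ s → a n = 0) → m s a = m t a := by
  let φ := gelfandStarTransform A
  refine ⟨fun s a => φ.symm (euclideanModulus s fun n => φ (a n)), fun s a => ?_,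
    fun s a b => ?_, fun s t a hst ha => ?_⟩
  · have h := congrArg φ.symm (star_euclideanModulus_mul_self s fun n => φ (a n))
    simpa only [map_mul, map_star, map_sum, StarAlgEquiv.symm_apply_apply] using h
  · obtain ⟨r, hr⟩ := exists_sum_star_sub_mul_sub_eq s (fun n => φ (a n)) fun n => φ (b n)
    refine ⟨φ.symm r, ?_⟩
    have h := congrArg φ.symm hr
    simpa only [map_mul, map_star, map_sum, map_sub, map_add, StarAlgEquiv.symm_apply_apply]
      using h
  · simp only [EmbeddingLike.apply_eq_iff_eq]
    exact euclideanModulus_congr hst fun n hn hns => by rw [ha n hn hns, map_zero]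

end Modulus

section Masa

variable {H : Type*} [NormedAddCommGroup H] [InnerProductSpace ℂ H] [CompleteSpace H]
  {D : StarSubalgebra ℂ (B H)}

lemma IsMasa.isClosed (hD : IsMasa D) : IsClosed (D : Set (B H)) := by
  have h : (D : Set (B H)) = ⋂ A ∈ D, {T | T * A = A * T} := by
    ext T
    simp only [SetLike.mem_coe, Set.mem_iInter, Set.mem_ofPred_eq]
    exact ⟨fun hT A hA => hD.1 T hT A hA, hD.2 T⟩
  rw [h]
  exact isClosed_biInter fun A _ =>
    isClosed_eq (continuous_id.mul continuous_const) (continuous_const.mul continuous_id)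

lemma sum_norm_sq_apply_eq {ι : Type*} (s : Finset ι) (a : ι → B H) (v : H) :
    ((∑ n ∈ s, ‖a n v‖ ^ 2 : ℝ) : ℂ) = ⟪v, (∑ n ∈ s, star (a n) * a n) v⟫_ℂ := by
  simp only [sum_apply, inner_sum, ContinuousLinearMap.mul_def,
    ContinuousLinearMap.comp_apply,
    ContinuousLinearMap.star_eq_adjoint, ContinuousLinearMap.adjoint_inner_right,
    inner_self_eq_norm_sq_to_K]
  push_cast
  rfl

lemma norm_sq_apply_eq (a : B H) (v : H) :
    ((‖a v‖ ^ 2 : ℝ) : ℂ) = ⟪v, (star a * a) v⟫_ℂ := by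
  simpa using sum_norm_sq_apply_eq (Finset.univ : Finset Unit) (fun _ => a) v

lemma sum_norm_sq_apply_eq_add {ι : Type*} {s : Finset ι} {a : ι → B H} {c r : B H}
    (h : ∑ n ∈ s, star (a n) * a n = star c * c + star r * r) (v : H) :
    ∑ n ∈ s, ‖a n v‖ ^ 2 = ‖c v‖ ^ 2 + ‖r v‖ ^ 2 := by
  have key := sum_norm_sq_apply_eq s a v
  rw [h, add_apply, inner_add_right, ← norm_sq_apply_eq, ← norm_sq_apply_eq] at key
  exact_mod_cast key

lemma IsMasa.exists_modulus (hD : IsMasa D) :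
    ∃ m : Finset ℕ → (ℕ → D) → D,
      (∀ s a (v : H), ∑ n ∈ s, ‖(a n : B H) v‖ ^ 2 = ‖(m s a : B H) v‖ ^ 2) ∧
      (∀ s a b (v : H), ‖(m s a : B H) v - (m s b : B H) v‖ ^ 2 ≤
        ∑ n ∈ s, ‖(a n : B H) v - (b n : B H) v‖ ^ 2) ∧
      ∀ s t a, s ⊆ t → (∀ n ∈ t, n ∉ s → a n = 0) → m s a = m t a := by
  let inst : CommCStarAlgebra D :=
    { StarSubalgebra.cstarAlgebra D (h_closed := hD.isClosed) with
      mul_comm := fun a b => Subtype.ext (hD.1 a a.2 b b.2) }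
  obtain ⟨m, hm₁, hm₂, hm₃⟩ := SchurHyper.exists_modulus D
  refine ⟨m, fun s a v => ?_, fun s a b v => ?_, hm₃⟩
  · have h := congrArg (Subtype.val : D → B H) (hm₁ s a)
    push_cast at h
    simpa using sum_norm_sq_apply_eq_add (s := s) (a := fun n => (a n : B H)) (r := 0)
      (by simpa using h.symm) v
  · obtain ⟨r, hr⟩ := hm₂ s a b
    have h := congrArg (Subtype.val : D → B H) hr
    push_cast at h
    have key := sum_norm_sq_apply_eq_add (a := fun n => (a n : B H) - (b n : B H)) h v
    simp only [sub_apply] at key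
    exact (le_add_of_nonneg_right (sq_nonneg _)).trans_eq key.symm

end Masa

section Cyclic

variable {H : Type*} [NormedAddCommGroup H] [InnerProductSpace ℂ H]

lemma apply_mem_topologicalClosure {K : Submodule ℂ H} {A : B H} (h : ∀ v ∈ K, A v ∈ K) {v : H}
    (hv : v ∈ K.topologicalClosure) : A v ∈ K.topologicalClosure :=
  map_mem_closure A.continuous hv h

variable [CompleteSpace H] {D : StarSubalgebra ℂ (B H)}

/-- The map `a ↦ a x` on `D`. -/
def orbitMap (D : StarSubalgebra ℂ (B H)) (x : H) : D →ₗ[ℂ] H where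
  toFun a := (a : B H) x
  map_add' _ _ := rfl
  map_smul' _ _ := rfl

@[simp] lemma orbitMap_apply (x : H) (a : D) : orbitMap D x a = (a : B H) x := rfl

/-- The closed cyclic subspace generated by `x`. -/
def cyclicSubspace (D : StarSubalgebra ℂ (B H)) (x : H) : Submodule ℂ H :=
  (LinearMap.range (orbitMap D x)).topologicalClosure

instance (x : H) : (cyclicSubspace D x).HasOrthogonalProjection :=
  inferInstanceAs (Submodule.topologicalClosure _).HasOrthogonalProjection

lemma apply_mem_cyclicSubspace {A : B H} (hA : A ∈ D) (x : H) : A x ∈ cyclicSubspace D x :=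
  Submodule.le_topologicalClosure _ ⟨⟨A, hA⟩, rfl⟩

lemma self_mem_cyclicSubspace (x : H) : x ∈ cyclicSubspace D x :=
  apply_mem_cyclicSubspace (one_mem D) x

lemma cyclicSubspace_invariant {A : B H} (hA : A ∈ D) {x v : H} (hv : v ∈ cyclicSubspace D x) :
    A v ∈ cyclicSubspace D x := by
  refine apply_mem_topologicalClosure ?_ hv
  rintro _ ⟨a, rfl⟩
  exact ⟨⟨A, hA⟩ * a, rfl⟩

lemma cyclicSubspace_le {K : Submodule ℂ H} (hK : IsClosed (K : Set H))
    (hinv : ∀ A ∈ D, ∀ v ∈ K, A v ∈ K) {x : H} (hx : x ∈ K) : cyclicSubspace D x ≤ K := by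
  refine Submodule.topologicalClosure_minimal _ ?_ hK
  rintro _ ⟨a, rfl⟩
  exact hinv a a.2 x hx

lemma isClosed_cyclicSubspace (x : H) : IsClosed (cyclicSubspace D x : Set H) :=
  Submodule.isClosed_topologicalClosure _

lemma denseRange_orbitMap_of_cyclicSubspace_eq_top {x : H} (h : cyclicSubspace D x = ⊤) :
    DenseRange (orbitMap D x) := by
  intro v
  have hv : v ∈ cyclicSubspace D x := h ▸ Submodule.mem_top
  exact hv

/-- The projection onto a `D`-invariant subspace belongs to `D`. -/
lemma IsMasa.starProjection_mem (hD : IsMasa D) (K : Submodule ℂ H) [K.HasOrthogonalProjection]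
    (hK : ∀ A ∈ D, ∀ v ∈ K, A v ∈ K) : K.starProjection ∈ D := by
  refine hD.2 _ fun A hA => ?_
  ext v
  refine Submodule.eq_starProjection_of_mem_orthogonal
    (hK A hA _ (K.starProjection_apply_mem v)) ?_
  change A v - A (K.starProjection v) ∈ Kᗮ
  rw [← map_sub, Submodule.mem_orthogonal]
  intro u hu
  rw [← ContinuousLinearMap.adjoint_inner_left]
  exact (Submodule.mem_orthogonal _ _).1 (K.sub_starProjection_mem_orthogonal v) _
    (hK _ (star_mem hA) u hu)

lemma mem_cyclicSubspace_add_smul (hD : IsMasa D) (f d : H) {c : ℂ} (hc : c ≠ 0) :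
    d ∈ cyclicSubspace D (f + c • (d - (cyclicSubspace D f).starProjection d)) := by
  set P := (cyclicSubspace D f).starProjection with hP
  have hPD : P ∈ D := hD.starProjection_mem _ fun A hA v hv => cyclicSubspace_invariant hA hv
  set w := d - P d with hw
  have hPf : P f = f := Submodule.starProjection_eq_self_iff.2 (self_mem_cyclicSubspace f)
  have hPw : P w = 0 := by
    rw [hw, map_sub, Submodule.starProjection_eq_self_iff.2
      ((cyclicSubspace D f).starProjection_apply_mem d), sub_self]
  set e := f + c • w with he
  have hPe : P e = f := by rw [he, map_add, map_smul, hPf, hPw, smul_zero, add_zero]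
  have hf : f ∈ cyclicSubspace D e := hPe ▸ apply_mem_cyclicSubspace hPD e
  have hPd : P d ∈ cyclicSubspace D e :=
    cyclicSubspace_le (isClosed_cyclicSubspace e)
      (fun A hA v hv => cyclicSubspace_invariant hA hv) hf
      ((cyclicSubspace D f).starProjection_apply_mem d)
  have hwe : w ∈ cyclicSubspace D e := by
    have h := Submodule.smul_mem _ c⁻¹ (Submodule.sub_mem _ (self_mem_cyclicSubspace e) hf)
    rwa [he, add_sub_cancel_left, inv_smul_smul₀ hc] at h
  have h := Submodule.add_mem _ hPd hwe
  rwa [hw, add_sub_cancel] at h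

/-- A masa on a separable Hilbert space has a cyclic vector. -/
lemma IsMasa.exists_cyclic [TopologicalSpace.SeparableSpace H] (hD : IsMasa D) :
    ∃ e : H, DenseRange (orbitMap D e) := by
  let d := TopologicalSpace.denseSeq H
  let G (i : ℕ × ℕ) : Set H := ⋃ a : D, {e | ‖(a : B H) e - d i.1‖ < 1 / ((i.2 : ℝ) + 1)}
  have hGo (i) : IsOpen (G i) := isOpen_iUnion fun a =>
    isOpen_lt (by fun_prop) continuous_const
  have hGd (i) : Dense (G i) := by
    intro f
    let w := d i.1 - (cyclicSubspace D f).starProjection (d i.1)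
    have hlim : Tendsto (fun c : ℂ => f + c • w) (𝓝[≠] 0) (𝓝 f) := by
      have h : Tendsto (fun c : ℂ => f + c • w) (𝓝 0) (𝓝 (f + (0 : ℂ) • w)) :=
        Continuous.tendsto (by fun_prop) 0
      rw [zero_smul, add_zero] at h
      exact h.mono_left nhdsWithin_le_nhds
    refine mem_closure_of_tendsto hlim (eventually_mem_nhdsWithin.mono fun c hc => ?_)
    have hmem : d i.1 ∈ closure (LinearMap.range (orbitMap D (f + c • w)) : Set H) :=
      mem_cyclicSubspace_add_smul hD f (d i.1) hc
    obtain ⟨_, ⟨a, rfl⟩, ha⟩ := Metric.mem_closure_iff.1 hmem (1 / ((i.2 : ℝ) + 1)) (by positivity)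
    rw [dist_eq_norm, norm_sub_rev] at ha
    exact Set.mem_iUnion.2 ⟨a, ha⟩
  obtain ⟨e, he⟩ := (dense_iInter_of_isOpen hGo hGd).nonempty
  refine ⟨e, denseRange_orbitMap_of_cyclicSubspace_eq_top (eq_top_iff.2 ?_)⟩
  have hd : Set.range d ⊆ cyclicSubspace D e := by
    rintro _ ⟨k, rfl⟩
    refine Metric.mem_closure_iff.2 fun ε hε => ?_
    obtain ⟨m, hm⟩ := exists_nat_one_div_lt hε
    obtain ⟨a, ha⟩ := Set.mem_iUnion.1 (Set.mem_iInter.1 he (k, m))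
    refine ⟨_, ⟨a, rfl⟩, ?_⟩
    rw [dist_eq_norm, norm_sub_rev]
    exact lt_trans ha hm
  intro v _
  exact closure_minimal hd (isClosed_cyclicSubspace e) (TopologicalSpace.denseRange_denseSeq H v)

/-- Every square-summable sequence of vectors is dominated by a single vector. -/
lemma IsMasa.exists_dominating (hD : IsMasa D) {e : H} (he : DenseRange (orbitMap D e))
    {x : ℕ → H} (hx : Summable fun n => ‖x n‖ ^ 2) :
    ∃ ξ : H, ∀ a ∈ D, ∀ N, ∑ n ∈ Finset.range N, ‖a (x n)‖ ^ 2 ≤ ‖a ξ‖ ^ 2 := by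
  obtain ⟨m, hm₁, hm₂, hm₃⟩ := hD.exists_modulus
  have happ (n k : ℕ) : ∃ a : D, ‖(a : B H) e - x n‖ ^ 2 ≤ (1 / 2) ^ k * (1 / 2) ^ n := by
    have hpos : (0 : ℝ) < (1 / 2) ^ k * (1 / 2) ^ n := by positivity
    obtain ⟨_, ⟨a, rfl⟩, ha⟩ := Metric.mem_closure_iff.1 (he (x n))
      (√((1 / 2) ^ k * (1 / 2) ^ n)) (Real.sqrt_pos.2 hpos)
    rw [dist_eq_norm, norm_sub_rev] at ha
    exact ⟨a, (Real.le_sqrt (norm_nonneg _) hpos.le).1 ha.le⟩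
  choose b hb using happ
  let a (k n : ℕ) : D := if n < k then b n k else 0
  let g (k n : ℕ) : ℝ := (1 / 2) ^ k * (1 / 2) ^ n + if n < k then 0 else ‖x n‖ ^ 2
  have hag (k n) : ‖(a k n : B H) e - x n‖ ^ 2 ≤ g k n := by
    by_cases h : n < k
    · simpa [a, g, h] using hb n k
    · simp only [a, g, h, if_false, ZeroMemClass.coe_zero, zero_apply, zero_sub, norm_neg]
      exact le_add_of_nonneg_left (by positivity)
  have hg0 (k n) : 0 ≤ g k n := (sq_nonneg _).trans (hag k n)
  have hgb (k n) : g k n ≤ (1 / 2) ^ n + ‖x n‖ ^ 2 := by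
    have h₁ : ((1 : ℝ) / 2) ^ k * (1 / 2) ^ n ≤ (1 / 2) ^ n :=
      mul_le_of_le_one_left (by positivity) (pow_le_one₀ (by norm_num) (by norm_num))
    refine add_le_add h₁ ?_
    split_ifs
    · positivity
    · exact le_rfl
  have hbs : Summable fun n => ((1 : ℝ) / 2) ^ n + ‖x n‖ ^ 2 := summable_geometric_two.add hx
  have hgs (k) : Summable (g k) := Summable.of_nonneg_of_le (hg0 k) (hgb k) hbs
  have hδ : Tendsto (fun k => ∑' n, g k n) atTop (𝓝 0) := by
    have h := tendsto_tsum_of_dominated_convergence (𝓕 := atTop) (f := g) (g := fun _ => 0) hbs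
      (fun n => ?_) (Eventually.of_forall fun k n => ?_)
    · simpa using h
    · have h₁ : Tendsto (fun k : ℕ => ((1 : ℝ) / 2) ^ k * (1 / 2) ^ n) atTop (𝓝 0) := by
        simpa only [zero_mul] using (tendsto_pow_atTop_nhds_zero_of_lt_one (r := (1 : ℝ) / 2)
          (by norm_num) (by norm_num)).mul_const (((1 : ℝ) / 2) ^ n)
      refine h₁.congr' ((eventually_gt_atTop n).mono fun k hk => ?_)
      simp [g, hk]
    · rw [Real.norm_of_nonneg (hg0 k n)]
      exact hgb k n
  let s (k : ℕ) : D := m (Finset.range k) (a k)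
  have hs (k M : ℕ) (hkM : k ≤ M) : s k = m (Finset.range M) (a k) :=
    hm₃ _ _ _ (Finset.range_mono hkM) fun n _ hn => if_neg fun h => hn (Finset.mem_range.2 h)
  have hdist (k M : ℕ) : ‖(s k : B H) e - (s M : B H) e‖ ^ 2 ≤
      2 * (∑' n, g k n + ∑' n, g M n) := by
    rw [hs k (max k M) (le_max_left _ _), hs M (max k M) (le_max_right _ _)]
    refine (hm₂ _ _ _ e).trans ?_
    calc ∑ n ∈ Finset.range (max k M), ‖(a k n : B H) e - (a M n : B H) e‖ ^ 2
        ≤ ∑ n ∈ Finset.range (max k M), 2 * (g k n + g M n) := by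
          refine Finset.sum_le_sum fun n _ => ?_
          have h := norm_sub_le_norm_sub_add_norm_sub ((a k n : B H) e) (x n) ((a M n : B H) e)
          rw [norm_sub_rev (x n)] at h
          have h₁ := hag k n
          have h₂ := hag M n
          nlinarith [sq_nonneg (‖(a k n : B H) e - x n‖ - ‖(a M n : B H) e - x n‖),
            norm_nonneg ((a k n : B H) e - (a M n : B H) e)]
      _ = 2 * (∑ n ∈ Finset.range (max k M), g k n + ∑ n ∈ Finset.range (max k M), g M n) := by
          rw [← Finset.mul_sum, Finset.sum_add_distrib]
      _ ≤ _ := by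
          gcongr
          · exact (hgs k).sum_le_tsum _ fun n _ => hg0 k n
          · exact (hgs M).sum_le_tsum _ fun n _ => hg0 M n
  have hcauchy : CauchySeq fun k => (s k : B H) e := by
    refine Metric.cauchySeq_iff.2 fun ε hε => ?_
    obtain ⟨K, hK⟩ := eventually_atTop.1
      (hδ.eventually_lt_const (show (0 : ℝ) < ε ^ 2 / 4 by positivity))
    refine ⟨K, fun k hk M hM => ?_⟩
    rw [dist_eq_norm]
    refine lt_of_pow_lt_pow_left₀ 2 hε.le ((hdist k M).trans_lt ?_)
    linarith [hK k hk, hK M hM]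
  obtain ⟨ξ, hξ⟩ := cauchySeq_tendsto_of_complete hcauchy
  have hax (n) : Tendsto (fun k => (a k n : B H) e) atTop (𝓝 (x n)) := by
    rw [tendsto_iff_norm_sub_tendsto_zero]
    have h : Tendsto (fun k => ‖(a k n : B H) e - x n‖ ^ 2) atTop (𝓝 0) :=
      squeeze_zero (fun k => sq_nonneg _)
        (fun k => (hag k n).trans ((hgs k).le_tsum n fun j _ => hg0 k j)) hδ
    simpa [Real.sqrt_sq] using h.sqrt
  refine ⟨ξ, fun c hc N => ?_⟩
  refine le_of_tendsto_of_tendsto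
    (tendsto_finsetSum _ fun n _ => (((c.continuous.tendsto _).comp (hax n)).norm.pow 2))
    (((c.continuous.tendsto _).comp hξ).norm.pow 2) ((eventually_ge_atTop N).mono fun k hk => ?_)
  have hcomm (a : D) : c ((a : B H) e) = (a : B H) (c e) :=
    congrArg (fun T : B H => T e) (hD.1 c hc a a.2)
  simp only [Function.comp_apply, hcomm]
  rw [← hm₁]
  exact Finset.sum_le_sum_of_subset_of_nonneg (Finset.range_mono hk) fun _ _ _ => sq_nonneg _

/-- A square-summable sequence factors through a cyclic vector, via a row contraction
with entries in the masa. -/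
lemma IsMasa.exists_factorization [TopologicalSpace.SeparableSpace H] (hD : IsMasa D)
    {x : ℕ → H} (hx : Summable fun n => ‖x n‖ ^ 2) :
    ∃ (ξ : H) (V : ℕ → B H), DenseRange (orbitMap D ξ) ∧ (∀ n, V n ∈ D) ∧
      (∀ n, V n ξ = x n) ∧ ∀ N v, ∑ n ∈ Finset.range N, ‖V n v‖ ^ 2 ≤ ‖v‖ ^ 2 := by
  obtain ⟨e, he⟩ := hD.exists_cyclic
  let x' : ℕ → H := fun n => Nat.casesOn n e x
  have hx' : Summable fun n => ‖x' n‖ ^ 2 := (summable_nat_add_iff 1).1 hx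
  obtain ⟨ξ, hξ'⟩ := hD.exists_dominating he hx'
  have hsum (a) (ha : a ∈ D) (N : ℕ) :
      ‖a e‖ ^ 2 + ∑ n ∈ Finset.range N, ‖a (x n)‖ ^ 2 ≤ ‖a ξ‖ ^ 2 := by
    have h := hξ' a ha (N + 1)
    rw [Finset.sum_range_succ'] at h
    rw [add_comm]
    exact h
  have hξ (a) (ha : a ∈ D) (N : ℕ) : ∑ n ∈ Finset.range N, ‖a (x n)‖ ^ 2 ≤ ‖a ξ‖ ^ 2 :=
    (le_add_of_nonneg_left (sq_nonneg _)).trans (hsum a ha N)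
  have hdense : DenseRange (orbitMap D ξ) := by
    refine denseRange_orbitMap_of_cyclicSubspace_eq_top (eq_top_iff.2 fun v _ => ?_)
    set P := (cyclicSubspace D ξ).starProjection
    have hPD : P ∈ D := hD.starProjection_mem _ fun A hA v hv => cyclicSubspace_invariant hA hv
    have hPξ : P ξ = ξ := Submodule.starProjection_eq_self_iff.2 (self_mem_cyclicSubspace ξ)
    have hPe : (1 - P) e = 0 := by
      have h := hsum (1 - P) (sub_mem (one_mem D) hPD) 0
      have h0 : (1 - P) ξ = 0 := by simp [hPξ]
      rw [h0] at h
      simpa using h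
    have hP : (1 - P : B H) = 0 := by
      refine ContinuousLinearMap.coeFn_injective (he.equalizer (1 - P).continuous
        (0 : B H).continuous (funext fun a => ?_))
      have h := congrArg (fun T : B H => T e) (hD.1 (1 - P) (sub_mem (one_mem D) hPD) a a.2)
      exact h.trans (by change (a : B H) ((1 - P) e) = 0; rw [hPe, map_zero])
    have hv : P v = v := by rw [← sub_eq_zero.1 hP]; rfl
    exact hv ▸ (cyclicSubspace D ξ).starProjection_apply_mem v
  have hle (n : ℕ) (a : D) : ‖orbitMap D (x n) a‖ ≤ 1 * ‖orbitMap D ξ a‖ := by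
    rw [one_mul]
    refine le_of_sq_le_sq ?_ (norm_nonneg _)
    exact (Finset.single_le_sum (f := fun n => ‖(a : B H) (x n)‖ ^ 2)
      (fun _ _ => sq_nonneg _) (Finset.self_mem_range_succ n)).trans (hξ a a.2 (n + 1))
  let V (n : ℕ) : B H := (orbitMap D (x n)).extendOfNorm (orbitMap D ξ)
  have hV (n : ℕ) (a : D) : V n ((a : B H) ξ) = (a : B H) (x n) :=
    LinearMap.extendOfNorm_eq hdense ⟨1, hle n⟩ a
  refine ⟨ξ, V, hdense, fun n => hD.2 _ fun A hA => ?_, fun n => hV n 1, fun N v => ?_⟩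
  · refine ContinuousLinearMap.coeFn_injective (hdense.equalizer (V n * A).continuous
      (A * V n).continuous (funext fun a => ?_))
    have h : V n (A ((a : B H) ξ)) = A ((a : B H) (x n)) := hV n ((⟨A, hA⟩ : D) * a)
    exact h.trans (congrArg A (hV n a).symm)
  · refine hdense.induction_on (p := fun v => ∑ n ∈ Finset.range N, ‖V n v‖ ^ 2 ≤ ‖v‖ ^ 2) v
      (isClosed_le (by fun_prop) (by fun_prop)) fun a => ?_
    simp only [orbitMap_apply, hV]
    exact hξ a a.2 N

end Cyclic

section Invariance

variable {H : Type*} [NormedAddCommGroup H] [InnerProductSpace ℂ H] [CompleteSpace H]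
  {D : StarSubalgebra ℂ (B H)}

lemma inner_star_mul_mul_apply (A S C : B H) (v w : H) :
    ⟪w, (star A * S * C) v⟫_ℂ = ⟪A w, S (C v)⟫_ℂ :=
  ContinuousLinearMap.adjoint_inner_right A w (S (C v))

lemma inner_sum_star_mul_mul_apply (V W : ℕ → B H) (S : B H) (N : ℕ) (v w : H) :
    ⟪w, (∑ n ∈ Finset.range N, star (W n) * S * V n) v⟫_ℂ =
      ∑ n ∈ Finset.range N, ⟪W n w, S (V n v)⟫_ℂ := by
  rw [sum_apply, inner_sum]
  exact Finset.sum_congr rfl fun n _ => inner_star_mul_mul_apply _ _ _ _ _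

lemma eq_zero_of_inner_orbitMap {ξ η : H} (hξ : DenseRange (orbitMap D ξ))
    (hη : DenseRange (orbitMap D η)) {T : B H}
    (h : ∀ a b : D, ⟪(b : B H) η, T ((a : B H) ξ)⟫_ℂ = 0) : T = 0 := by
  refine ContinuousLinearMap.ext fun v => ext_inner_left ℂ fun w => ?_
  rw [zero_apply, inner_zero_right]
  refine hξ.induction_on (p := fun v => ⟪w, T v⟫_ℂ = 0) v
    (isClosed_eq (by fun_prop) continuous_const) fun a => ?_
  exact hη.induction_on (p := fun w => ⟪w, T (orbitMap D ξ a)⟫_ℂ = 0) w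
    (isClosed_eq (by fun_prop) continuous_const) fun b => h a b

lemma norm_sum_star_mul_mul_le {V W : ℕ → B H} {N : ℕ}
    (hV : ∀ v, ∑ n ∈ Finset.range N, ‖V n v‖ ^ 2 ≤ ‖v‖ ^ 2)
    (hW : ∀ v, ∑ n ∈ Finset.range N, ‖W n v‖ ^ 2 ≤ ‖v‖ ^ 2) (S : B H) :
    ‖∑ n ∈ Finset.range N, star (W n) * S * V n‖ ≤ ‖S‖ := by
  refine opNorm_le_of_norm_inner_le (norm_nonneg S) fun v w => ?_
  rw [inner_sum_star_mul_mul_apply]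
  calc ‖∑ n ∈ Finset.range N, ⟪W n w, S (V n v)⟫_ℂ‖
      ≤ ∑ n ∈ Finset.range N, ‖S‖ * (‖V n v‖ * ‖W n w‖) := by
        refine (norm_sum_le _ _).trans (Finset.sum_le_sum fun n _ => ?_)
        refine (norm_inner_le_norm _ _).trans ?_
        calc ‖W n w‖ * ‖S (V n v)‖ ≤ ‖W n w‖ * (‖S‖ * ‖V n v‖) := by
              gcongr; exact S.le_opNorm _
          _ = _ := by ring
    _ ≤ ‖S‖ * (‖v‖ * ‖w‖) := by
        rw [← Finset.mul_sum]
        refine mul_le_mul_of_nonneg_left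
          ((Real.sum_mul_le_sqrt_mul_sqrt _ _ _).trans ?_) (norm_nonneg S)
        exact mul_le_mul ((Real.sqrt_le_sqrt (hV v)).trans_eq (Real.sqrt_sq (norm_nonneg v)))
          ((Real.sqrt_le_sqrt (hW w)).trans_eq (Real.sqrt_sq (norm_nonneg w)))
          (Real.sqrt_nonneg _) (norm_nonneg v)
    _ = ‖S‖ * ‖v‖ * ‖w‖ := by ring

/-- A normal functional which annihilates `D S D` annihilates `Ψ S` for every Schur
multiplier `Ψ`. -/
lemma IsMasa.functional_apply_eq_zero [TopologicalSpace.SeparableSpace H] (hD : IsMasa D)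
    {ω : B H →ₗ[ℂ] ℂ} (hω : IsNormalFunctional H ω) {S : B H}
    (hS : ∀ A ∈ D, ∀ C ∈ D, ω (A * S * C) = 0) {Ψ : B H →L[ℂ] B H}
    (hΨ : IsSchurMultiplier D Ψ) : ω (Ψ S) = 0 := by
  obtain ⟨x, y, hx, hy, hxy⟩ := hω
  have hlim (T : B H) : Tendsto (fun N => ∑ n ∈ Finset.range N, ⟪y n, T (x n)⟫_ℂ)
      (hyperfilter ℕ : Filter ℕ) (𝓝 (ω T)) := by
    rw [hxy]
    exact ((summable_norm_inner_apply hx hy T).of_norm.hasSum.tendsto_sum_nat).mono_left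
      Nat.hyperfilter_le_atTop
  obtain ⟨ξ, V, hξ, hVD, hVξ, hV⟩ := hD.exists_factorization hx
  obtain ⟨η, W, hη, hWD, hWη, hW⟩ := hD.exists_factorization hy
  obtain ⟨R, hR'⟩ : ∃ R : ℕ → B H, ∀ N, R N = ∑ n ∈ Finset.range N, star (W n) * S * V n :=
    ⟨_, fun _ => rfl⟩
  obtain ⟨R', -, hR⟩ := exists_tendsto_weakStar (hyperfilter ℕ) (T := R)
    fun N => hR' N ▸ norm_sum_star_mul_mul_le (hV N) (hW N) S
  have hR0 : R' = 0 := by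
    refine eq_zero_of_inner_orbitMap hξ hη fun a b => ?_
    have h₁ := tendsto_weakStar_iff.1 hR _
      (isNormalFunctional_vectorFunctional ((a : B H) ξ) ((b : B H) η))
    have h₂ := hlim (star (b : B H) * S * a)
    rw [hS _ (star_mem b.2) _ a.2] at h₂
    refine tendsto_nhds_unique h₁ (h₂.congr fun N => ?_)
    rw [vectorFunctional_apply, hR', inner_sum_star_mul_mul_apply]
    refine Finset.sum_congr rfl fun n _ => ?_
    have hb : W n ((b : B H) η) = (b : B H) (y n) := by
      rw [← hWη]
      exact congrArg (fun T : B H => T η) (hD.1 _ (hWD n) b b.2)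
    have ha : V n ((a : B H) ξ) = (a : B H) (x n) := by
      rw [← hVξ]
      exact congrArg (fun T : B H => T ξ) (hD.1 _ (hVD n) a a.2)
    rw [hb, ha, inner_star_mul_mul_apply]
  have hΨR : Tendsto (fun N => Ψ (R N)) (hyperfilter ℕ : Filter ℕ)
      (@nhds _ (weakStarTopology H) 0) := by
    have h := (@Continuous.tendsto _ _ (weakStarTopology H) (weakStarTopology H) _ hΨ.1 R').comp hR
    rwa [hR0, map_zero] at h
  have h₁ := tendsto_weakStar_iff.1 hΨR _ (isNormalFunctional_vectorFunctional ξ η)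
  rw [map_zero] at h₁
  refine tendsto_nhds_unique (hlim (Ψ S)) (h₁.congr fun N => ?_)
  have hN : Ψ (R N) = ∑ n ∈ Finset.range N, star (W n) * Ψ S * V n := by
    rw [hR', map_sum]
    exact Finset.sum_congr rfl fun n _ => hΨ.2 _ (star_mem (hWD n)) _ (hVD n) S
  rw [vectorFunctional_apply, hN, inner_sum_star_mul_mul_apply]
  simp only [hVξ, hWη]

/-- The fixed points of a Schur multiplier are invariant under every Schur multiplier. -/
lemma IsMasa.fixed_of_fixed [TopologicalSpace.SeparableSpace H] (hD : IsMasa D)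
    {Φ Ψ : B H →L[ℂ] B H} (hΦ : IsSchurMultiplier D Φ) (hΨ : IsSchurMultiplier D Ψ) {S : B H}
    (hS : Φ S = S) : Φ (Ψ S) = Ψ S := by
  refine ContinuousLinearMap.ext fun x => ext_inner_left ℂ fun y => ?_
  let ω : B H →ₗ[ℂ] ℂ := vectorFunctional x y ∘ₗ (Φ : B H →ₗ[ℂ] B H)
  have hω : IsNormalFunctional H ω := by
    refine isNormalFunctional_of_continuous ω ?_
    have h := continuous_of_isNormalFunctional (isNormalFunctional_vectorFunctional x y)
    exact @Continuous.comp _ _ _ (weakStarTopology H) (weakStarTopology H) _ Φ _ h hΦ.1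
  have h := hD.functional_apply_eq_zero (S := S) (isNormalFunctional_add hω
    (isNormalFunctional_smul (-1) (isNormalFunctional_vectorFunctional x y)))
    (fun A hA C hC => by simp [ω, hΦ.2 A hA C hC, hS]) hΨ
  simpa [ω, ← sub_eq_add_neg, sub_eq_zero] using h

end Invariance

section Arveson

variable {H : Type*} [NormedAddCommGroup H] [InnerProductSpace ℂ H]

lemma arveson_nonneg (T : B H) (X : Set (B H)) : 0 ≤ arveson T X :=
  Real.iSup_nonneg fun _ => Real.iInf_nonneg fun _ => norm_nonneg _

lemma arveson_le {T : B H} {X : Set (B H)} {c : ℝ} (hc : 0 ≤ c)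
    (h : ∀ ξ : H, ‖ξ‖ = 1 → ∀ ε > 0, ∃ S ∈ X, ‖T ξ - S ξ‖ ≤ c + ε) : arveson T X ≤ c := by
  refine Real.iSup_le (fun ξ => le_of_forall_pos_le_add fun ε hε => ?_) hc
  obtain ⟨S, hS, hle⟩ := h ξ.1 ξ.2 ε hε
  exact (ciInf_le ⟨0, by rintro _ ⟨S, rfl⟩; exact norm_nonneg _⟩ (⟨S, hS⟩ : X)).trans hle

lemma exists_norm_sub_le_arveson (T : B H) (X : Submodule ℂ (B H)) (ζ : H) {ε : ℝ} (hε : 0 < ε) :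
    ∃ S ∈ X, ‖T ζ - S ζ‖ ≤ arveson T X * ‖ζ‖ + ε := by
  rcases eq_or_ne ζ 0 with rfl | hζ
  · exact ⟨0, X.zero_mem, by simpa using hε.le⟩
  have hζ' : 0 < ‖ζ‖ := norm_pos_iff.2 hζ
  obtain ⟨u, hu, hζu⟩ : ∃ u : H, ‖u‖ = 1 ∧ ζ = (‖ζ‖ : ℂ) • u :=
    ⟨(‖ζ‖⁻¹ : ℂ) • ζ, by simp [norm_smul, hζ],
      (smul_inv_smul₀ (by exact_mod_cast hζ'.ne') ζ).symm⟩
  have hbdd (ξ : {ξ : H // ‖ξ‖ = 1}) : BddBelow (Set.range fun S : (X : Set (B H)) =>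
      ‖T ξ.1 - S.1 ξ.1‖) := ⟨0, by rintro _ ⟨S, rfl⟩; exact norm_nonneg _⟩
  have hle : ⨅ S : (X : Set (B H)), ‖T u - S.1 u‖ ≤ arveson T X := by
    refine le_ciSup (f := fun ξ : {ξ : H // ‖ξ‖ = 1} =>
      ⨅ S : (X : Set (B H)), ‖T ξ.1 - S.1 ξ.1‖) ⟨‖T‖, ?_⟩ ⟨u, hu⟩
    rintro _ ⟨ξ, rfl⟩
    refine (ciInf_le (hbdd ξ) ⟨0, X.zero_mem⟩).trans ?_
    simpa [ξ.2] using T.le_opNorm ξ.1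
  have : Nonempty (X : Set (B H)) := ⟨⟨0, X.zero_mem⟩⟩
  obtain ⟨S, hS⟩ := exists_lt_of_ciInf_lt
    (hle.trans_lt (lt_add_of_pos_right _ (div_pos hε hζ')))
  refine ⟨S.1, S.2, ?_⟩
  have hsub : T ζ - S.1 ζ = (‖ζ‖ : ℂ) • (T u - S.1 u) := by
    rw [smul_sub, ← map_smul, ← map_smul, ← hζu]
  calc ‖T ζ - S.1 ζ‖ = ‖ζ‖ * ‖T u - S.1 u‖ := by
        rw [hsub, norm_smul, Complex.norm_real, norm_norm]
    _ ≤ ‖ζ‖ * (arveson T X + ε / ‖ζ‖) := by gcongr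
    _ = arveson T X * ‖ζ‖ + ε := by field_simp

lemma le_sInf_mul {s : Set ℝ} (hs : s.Nonempty) {d a : ℝ} (ha : 0 ≤ a)
    (h : ∀ k ∈ s, d ≤ k * a) : d ≤ sInf s * a := by
  rcases ha.eq_or_lt with rfl | ha
  · obtain ⟨k, hk⟩ := hs
    simpa using h k hk
  · rw [← div_le_iff₀ ha]
    exact le_csInf hs fun k hk => (div_le_iff₀ ha).2 (h k hk)

lemma infDist_le_hyperConst_mul {X : Set (B H)} (hX : Hyperreflexive X) (T : B H) :
    Metric.infDist T X ≤ hyperConst X * arveson T X :=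
  le_sInf_mul hX (arveson_nonneg T X) fun _ hk => hk.2 T

lemma hyperConst_nonneg (X : Set (B H)) : 0 ≤ hyperConst X :=
  Real.sInf_nonneg fun _ hk => hk.1.le

lemma norm_sub_le_lam_mul {Φ : B H →L[ℂ] B H} (hΦ : (lamSet Φ).Nonempty) (T : B H) :
    ‖T - Φ T‖ ≤ lam Φ * arveson T (Set.range Φ) :=
  le_sInf_mul hΦ (arveson_nonneg T _) fun _ hk => hk.2 T

variable [CompleteSpace H] {D : StarSubalgebra ℂ (B H)}

/-- Compressing away `U` on both sides turns the Arveson distance to `U + V` into the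
Arveson distance to the range of `Φ`. -/
lemma arveson_compression_le {U V : Submodule ℂ (B H)} {Φ : B H →L[ℂ] B H}
    (hΦ : ∀ A ∈ D, ∀ C ∈ D, ∀ T : B H, Φ (A * T * C) = A * Φ T * C)
    (hV : ∀ F ∈ V, Φ F = F) {P Q : B H} (hP : P ∈ D) (hQ : Q ∈ D) (hP1 : ‖P‖ ≤ 1)
    (hQ1 : ‖Q‖ ≤ 1) (hU : ∀ S ∈ U, Q * S * P = 0) (T : B H) :
    arveson (Q * T * P) (Set.range Φ) ≤ arveson T (U ⊔ V : Submodule ℂ (B H)) := by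
  refine arveson_le (arveson_nonneg _ _) fun ζ hζ ε hε => ?_
  obtain ⟨_, hS, hle⟩ := exists_norm_sub_le_arveson T (U ⊔ V) (P ζ) hε
  obtain ⟨R, hR, F, hF, rfl⟩ := Submodule.mem_sup.1 hS
  refine ⟨Q * F * P, ⟨Q * F * P, by rw [hΦ Q hQ P hP, hV F hF]⟩, ?_⟩
  have hQRP : Q (R (P ζ)) = 0 := congrArg (fun T : B H => T ζ) (hU R hR)
  have heq : (Q * T * P) ζ - (Q * F * P) ζ = Q (T (P ζ) - (R + F) (P ζ)) := by
    rw [map_sub, add_apply, map_add, hQRP, zero_add]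
    rfl
  rw [heq]
  calc ‖Q (T (P ζ) - (R + F) (P ζ))‖ ≤ 1 * ‖T (P ζ) - (R + F) (P ζ)‖ :=
        Q.le_of_opNorm_le hQ1 _
    _ ≤ arveson T (U ⊔ V : Submodule ℂ (B H)) * ‖P ζ‖ + ε := by rw [one_mul]; exact hle
    _ ≤ arveson T (U ⊔ V : Submodule ℂ (B H)) + ε := by
        gcongr
        refine mul_le_of_le_one_right (arveson_nonneg _ _) ?_
        simpa [hζ] using P.le_of_opNorm_le hP1 ζ

lemma IsMasa.arveson_sub_le (hD : IsMasa D) {U V : Submodule ℂ (B H)} (hU : IsBimodule D U)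
    {Φ : B H →L[ℂ] B H} (hΦ : ∀ A ∈ D, ∀ C ∈ D, ∀ T : B H, Φ (A * T * C) = A * Φ T * C)
    (hV : ∀ F ∈ V, Φ F = F) {l : ℝ} (hl : 0 ≤ l)
    (hΦl : ∀ T, ‖T - Φ T‖ ≤ l * arveson T (Set.range Φ)) (T : B H) :
    arveson (T - Φ T) U ≤ l * arveson T (U ⊔ V : Submodule ℂ (B H)) := by
  refine arveson_le (mul_nonneg hl (arveson_nonneg _ _)) fun ξ hξ ε hε => ?_
  let M : Submodule ℂ H := U.map (ContinuousLinearMap.apply ℂ H ξ : B H →ₗ[ℂ] H)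
  let K : Submodule ℂ H := M.topologicalClosure
  have hM : ∀ S ∈ U, S ξ ∈ M := fun S hS => ⟨S, hS, rfl⟩
  have hMinv : ∀ A ∈ D, ∀ v ∈ M, A v ∈ M := by
    rintro A hA _ ⟨S, hS, rfl⟩
    exact hM (A * S) (by simpa using hU A hA 1 (one_mem D) S hS)
  have hQ₀ : K.starProjection ∈ D :=
    hD.starProjection_mem K fun A hA v hv => apply_mem_topologicalClosure (hMinv A hA) hv
  let Q : B H := 1 - K.starProjection
  have hQ : Q ∈ D := sub_mem (one_mem D) hQ₀
  have hQK {v : H} (hv : v ∈ K) : Q v = 0 := by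
    simp [Q, Submodule.starProjection_eq_self_iff.2 hv]
  have hQ1 : ‖Q‖ ≤ 1 := by
    have h : Q = Kᗮ.starProjection := (Submodule.starProjection_orthogonal' K).symm
    exact h ▸ Submodule.starProjection_norm_le _
  let P : B H := (cyclicSubspace D ξ).starProjection
  have hP : P ∈ D := hD.starProjection_mem _ fun A hA v hv => cyclicSubspace_invariant hA hv
  have hPξ : P ξ = ξ := Submodule.starProjection_eq_self_iff.2 (self_mem_cyclicSubspace ξ)
  have hQUP : ∀ S ∈ U, Q * S * P = 0 := by
    intro S hS
    have hle : cyclicSubspace D ξ ≤ K.comap (S : H →ₗ[ℂ] H) := by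
      refine Submodule.topologicalClosure_minimal _ ?_
        ((Submodule.isClosed_topologicalClosure M).preimage S.continuous)
      rintro _ ⟨a, rfl⟩
      exact Submodule.le_topologicalClosure M
        (hM (S * a) (by simpa using hU 1 (one_mem D) a a.2 S hS))
    ext v
    exact hQK (hle ((cyclicSubspace D ξ).starProjection_apply_mem v))
  obtain ⟨_, ⟨S, hS, rfl⟩, hSε⟩ := Metric.mem_closure_iff.1
    (K.starProjection_apply_mem ((T - Φ T) ξ)) ε hε
  refine ⟨S, hS, ?_⟩
  have hQT : Q ((T - Φ T) ξ) = (Q * T * P - Φ (Q * T * P)) ξ := by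
    rw [hΦ Q hQ P hP]
    simp only [sub_apply, map_sub, ContinuousLinearMap.mul_def, ContinuousLinearMap.comp_apply,
      hPξ]
  calc ‖(T - Φ T) ξ - S ξ‖
      ≤ ‖Q ((T - Φ T) ξ)‖ + ‖K.starProjection ((T - Φ T) ξ) - S ξ‖ :=
        norm_sub_le_norm_sub_add_norm_sub _ _ _
    _ ≤ l * arveson T (U ⊔ V : Submodule ℂ (B H)) + ε := by
        gcongr
        · rw [hQT]
          refine ((Q * T * P - Φ (Q * T * P)).le_opNorm ξ).trans ?_
          rw [hξ, mul_one]
          refine (hΦl _).trans (mul_le_mul_of_nonneg_left ?_ hl)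
          exact arveson_compression_le hΦ hV hP hQ (Submodule.starProjection_norm_le _) hQ1
            hQUP T
        · rw [dist_eq_norm] at hSε
          exact hSε.le

end Arveson



section Main

variable {H : Type*} [NormedAddCommGroup H] [InnerProductSpace ℂ H] [CompleteSpace H]
  {D : StarSubalgebra ℂ (B H)}

/-- The ranges of a decreasing sequence of Schur idempotents decrease. -/
lemma IsMasa.apply_apply_of_le [TopologicalSpace.SeparableSpace H] (hD : IsMasa D)
    {Φ : ℕ → (B H →L[ℂ] B H)} (hΦ : ∀ n, IsSchurIdempotent D (Φ n))
    (hdec : ∀ n, (Φ (n + 1)).comp (Φ n) = Φ (n + 1)) {m n : ℕ} (hmn : m ≤ n) (T : B H) :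
    Φ m (Φ n T) = Φ n T := by
  have hfix (k : ℕ) (S : B H) : Φ k (Φ k S) = Φ k S := DFunLike.congr_fun (hΦ k).2 S
  induction n, hmn using Nat.le_induction with
  | base => exact hfix m T
  | succ n _ ih =>
    have h := hD.fixed_of_fixed (hΦ m).1 (hΦ (n + 1)).1 ih
    rwa [show Φ (n + 1) (Φ n T) = Φ (n + 1) T from DFunLike.congr_fun (hdec n) T] at h

/-- If `T - Φₙ T` is within `c` of `U` for all `n`, then `T` is within `c` of
`U + ⋂ₙ ran Φₙ`, by weak* compactness. -/
lemma infDist_sup_le {U V : Submodule ℂ (B H)} (hU : WStarClosed H (U : Set (B H)))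
    {Φ : ℕ → (B H →L[ℂ] B H)} (hcont : ∀ n, WStarContinuous H (Φ n))
    (hbdd : BddAbove (Set.range fun n => ‖Φ n‖))
    (hle : ∀ m n, m ≤ n → ∀ T, Φ m (Φ n T) = Φ n T)
    (hV : ∀ A, (∀ n, Φ n A = A) → A ∈ V) {T : B H} {c : ℝ}
    (hc : ∀ n, Metric.infDist (T - Φ n T) U ≤ c) :
    Metric.infDist T (U ⊔ V : Submodule ℂ (B H)) ≤ c := by
  obtain ⟨M, hM⟩ := hbdd
  have happ (n : ℕ) : ∃ S ∈ U, ‖T - Φ n T - S‖ ≤ c + 1 / ((n : ℝ) + 1) := by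
    obtain ⟨S, hS, h⟩ := (Metric.infDist_lt_iff ⟨0, U.zero_mem⟩).1
      ((hc n).trans_lt (lt_add_of_pos_right c (Nat.one_div_pos_of_nat (n := n))))
    exact ⟨S, hS, by rw [← dist_eq_norm]; exact h.le⟩
  choose S hS hSc using happ
  obtain ⟨A, -, hA⟩ := exists_tendsto_weakStar (hyperfilter ℕ) (T := fun n => Φ n T)
    (C := M * ‖T‖) fun n => (Φ n).le_of_opNorm_le (hM ⟨n, rfl⟩) T
  obtain ⟨R, -, hR⟩ := exists_tendsto_weakStar (hyperfilter ℕ) (T := fun n => T - Φ n T - S n)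
    (C := c + 1) fun n => (hSc n).trans (by
      gcongr
      rw [div_le_one (by positivity)]
      linarith [n.cast_nonneg (α := ℝ)])
  have hRc : ‖R‖ ≤ c := by
    refine norm_le_of_tendsto_weakStar hR ?_ hSc
    simpa using (tendsto_const_nhds.add
      (tendsto_one_div_add_atTop_nhds_zero_nat (𝕜 := ℝ))).mono_left Nat.hyperfilter_le_atTop
  have hSlim : Tendsto S (hyperfilter ℕ : Filter ℕ)
      (@nhds _ (weakStarTopology H) (T - A - R)) := by
    refine tendsto_weakStar_iff.2 fun ω hω => ?_
    have h := (tendsto_const_nhds (x := ω T)).sub (tendsto_weakStar_iff.1 hA ω hω)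
      |>.sub (tendsto_weakStar_iff.1 hR ω hω)
    simpa using h
  have hmemU : T - A - R ∈ U :=
    @IsClosed.mem_of_tendsto _ (weakStarTopology H) _ _ _ _ _ _ hU hSlim
      (Eventually.of_forall hS)
  have hmemV : A ∈ V := by
    refine hV A fun m => ?_
    refine (tendsto_weakStar_unique (F := (hyperfilter ℕ : Filter ℕ)) ?_ hA)
    refine ((@Continuous.tendsto _ _ (weakStarTopology H) (weakStarTopology H) _
      (hcont m) A).comp hA).congr' ?_
    filter_upwards [Nat.hyperfilter_le_atTop (eventually_ge_atTop m)] with n hn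
    exact hle m n hn T
  refine (Metric.infDist_le_dist_of_mem
    (Submodule.add_mem_sup hmemU hmemV)).trans ?_
  rwa [dist_eq_norm, show T - (T - A - R + A) = R by abel]

end Main

end SchurHyper

/-- if `U` is a hyperreflexive weak* closed masa-bimodule and `V`
is an approximately H-injective masa-bimodule (witnessed by a uniformly bounded
decreasing sequence `(Φₙ)` in `𝔉H` with `λ(Φₙ) ≤ λ` and `V = ⋂ₙ ran Φₙ`), then
`U + V` is hyperreflexive and `d(T, U + V) ≤ k(U)·λ·α(T, U + V)` for all `T`. -/
theorem stmt12 {H : Type*} [NormedAddCommGroup H] [InnerProductSpace ℂ H] [CompleteSpace H]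
    [TopologicalSpace.SeparableSpace H]
    (D : StarSubalgebra ℂ (B H)) (hD : IsMasa D)
    (U : Submodule ℂ (B H)) (hUbim : IsBimodule D U)
    (hUcl : WStarClosed H (U : Set (B H))) (hUhr : Hyperreflexive (U : Set (B H)))
    (V : Submodule ℂ (B H)) (hVbim : IsBimodule D V)
    (l : ℝ) (hl : 0 < l) (Φ : ℕ → (B H →L[ℂ] B H))
    (hΦ : ∀ n, MemFH D (Φ n))
    (hΦbdd : BddAbove (Set.range fun n => ‖Φ n‖))
    (hΦdec : ∀ n, (Φ (n + 1)).comp (Φ n) = Φ (n + 1))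
    (hV : (V : Set (B H)) = ⋂ n, Set.range ⇑(Φ n))
    (hΦl : ∀ n, lam (Φ n) ≤ l) :
    Hyperreflexive ((U : Set (B H)) + (V : Set (B H))) ∧
    ∀ T : B H, Metric.infDist T ((U : Set (B H)) + (V : Set (B H))) ≤
      hyperConst (U : Set (B H)) * l *
        arveson T ((U : Set (B H)) + (V : Set (B H))) := by
  have hid (n : ℕ) (S : B H) : Φ n (Φ n S) = Φ n S := DFunLike.congr_fun (hΦ n).1.2 S
  have hmemV (F : B H) : F ∈ V ↔ ∀ n, Φ n F = F := by
    rw [← SetLike.mem_coe, hV, Set.mem_iInter]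
    refine forall_congr' fun n => ⟨?_, fun h => ⟨F, h⟩⟩
    rintro ⟨S, rfl⟩
    exact hid n S
  have hbound (T : B H) : Metric.infDist T ((U : Set (B H)) + (V : Set (B H))) ≤
      hyperConst (U : Set (B H)) * l * arveson T ((U : Set (B H)) + (V : Set (B H))) := by
    rw [← Submodule.coe_sup]
    refine infDist_sup_le hUcl (fun n => (hΦ n).1.1.1) hΦbdd
      (fun m n hmn => hD.apply_apply_of_le (fun n => (hΦ n).1) hΦdec hmn)
      (fun A => (hmemV A).2) fun n => ?_
    refine (infDist_le_hyperConst_mul hUhr _).trans ?_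
    rw [mul_assoc]
    refine mul_le_mul_of_nonneg_left ?_ (hyperConst_nonneg _)
    exact hD.arveson_sub_le hUbim (hΦ n).1.1.2 (fun F hF => (hmemV F).1 hF n) hl.le
      (fun T => (norm_sub_le_lam_mul (hΦ n).2 T).trans
        (mul_le_mul_of_nonneg_right (hΦl n) (arveson_nonneg _ _))) T
  refine ⟨⟨hyperConst (U : Set (B H)) * l + 1,
    by have := hyperConst_nonneg (U : Set (B H)); positivity, fun T => (hbound T).trans ?_⟩, hbound⟩
  exact mul_le_mul_of_nonneg_right (by linarith) (arveson_nonneg _ _)
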